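/- Fix a finite alphabet A and a finite set B of nonempty words over A such that no element of B is a factor of another element of B. For v ∈ B and n ≥ 1, let c_v(n) = Σ (−1)^{|S|} over all clusters (w, S) with |w| = n whose occurrence starting at position 0 is (0, v). Then c_v(n) = 0 for n < |v|, and for all n ≥ |v|: c_v(n) = −[n = |v|] − Σ_{u ∈ B} Σ_{r ∈ O(v,u)} c_u(n − |v| + |r|), where [n = |v|] is 1 if n = |v| and 0 otherwise, and O(v,u) is the set of nonempty words r that are simultaneously a proper suffix of v and a proper prefix of u. -/

import Mathlib

open scoped Classical

/-- The set of occurrences of forbidden words of `B` in the word `w`: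
pairs `(i, b)` with `b ∈ B` such that `b` occurs as a factor of `w` starting at position `i`. -/
def Occ {A : Type} [DecidableEq A] (B : Finset (List A)) (w : List A) :
    Finset (ℕ × List A) :=
  (Finset.range (w.length + 1) ×ˢ B).filter fun p =>
    p.1 + p.2.length ≤ w.length ∧ (w.drop p.1).take p.2.length = p.2

/-- Two occurrences `p = (i, b)` and `q = (i', b')` overlap if they share at least one
position, i.e. the intervals `[i, i + |b|)` and `[i', i' + |b'|)` intersect. -/
def Overlaps {A : Type} (p q : ℕ × List A) : Prop :=
  ∃ j, p.1 ≤ j ∧ j < p.1 + p.2.length ∧ q.1 ≤ j ∧ j < q.1 + q.2.length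

/-- `(w, S)` is a cluster: `S` is a nonempty set of occurrences of `B` in `w`, some occurrence
starts at position 0, the occurrences of `S` cover every position of `w`, and any two
occurrences that are consecutive in increasing order of starting position (no occurrence of
`S` starts strictly between them) overlap. -/
def IsCluster {A : Type} [DecidableEq A] (B : Finset (List A)) (w : List A)
    (S : Finset (ℕ × List A)) : Prop :=
  S ⊆ Occ B w ∧ S.Nonempty ∧
    (∃ p ∈ S, p.1 = 0) ∧
    (∀ j < w.length, ∃ p ∈ S, p.1 ≤ j ∧ j < p.1 + p.2.length) ∧
    (∀ p ∈ S, ∀ q ∈ S, p.1 < q.1 → (∀ r ∈ S, ¬(p.1 < r.1 ∧ r.1 < q.1)) → Overlaps p q)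


/-- `c_v(n)`: the signed count `Σ (-1)^{|S|}` over all clusters `(w, S)` with `|w| = n` whose
occurrence starting at position 0 is `(0, v)`. -/
noncomputable def clusterCountFrom (A : Type) [Fintype A] [DecidableEq A]
    (B : Finset (List A)) (v : List A) (n : ℕ) : ℤ :=
  ∑ w : Fin n → A, ∑ S ∈ (Occ B (List.ofFn w)).powerset,
    if IsCluster B (List.ofFn w) S ∧ (0, v) ∈ S then (-1 : ℤ) ^ S.card else 0

/-- `O(v, u)`: the set of possible overlaps of `v` and `u`, i.e. nonempty words `r` that are
simultaneously a proper suffix of `v` and a proper prefix of `u`. -/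
def overlapSet {A : Type} [DecidableEq A] (v u : List A) : Finset (List A) :=
  v.tails.toFinset.filter fun r => r ≠ [] ∧ r ≠ v ∧ r <+: u ∧ r ≠ u

section ClusterRecursion

variable {A : Type}

/-- Translation of marked occurrences by `d` positions to the right. -/
def shiftOcc (A : Type) (d : ℕ) : ℕ × List A ↪ ℕ × List A where
  toFun p := (p.1 + d, p.2)
  inj' p q h := by
    simp only [Prod.mk.injEq, Nat.add_right_cancel_iff] at h
    exact Prod.ext h.1 h.2

theorem mem_map_shiftOcc {S : Finset (ℕ × List A)} {d : ℕ} {q : ℕ × List A} :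
    q ∈ S.map (shiftOcc A d) ↔ ∃ p ∈ S, (p.1 + d, p.2) = q :=
  Finset.mem_map

theorem overlaps_shift_iff {p q : ℕ × List A} (d : ℕ) :
    Overlaps (p.1 + d, p.2) (q.1 + d, q.2) ↔ Overlaps p q := by
  constructor
  · rintro ⟨j, h1, h2, h3, h4⟩
    dsimp only at h1 h2 h3 h4
    exact ⟨j - d, by omega, by omega, by omega, by omega⟩
  · rintro ⟨j, h1, h2, h3, h4⟩
    refine ⟨j + d, ?_, ?_, ?_, ?_⟩ <;> dsimp only <;> omega

theorem zero_notMem_map_shiftOcc {S : Finset (ℕ × List A)} {d : ℕ} (hd : 0 < d) (v : List A) :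
    (0, v) ∉ S.map (shiftOcc A d) := by
  rw [mem_map_shiftOcc]
  rintro ⟨p, _, h⟩
  have := congrArg Prod.fst h
  dsimp only at this
  omega

variable [DecidableEq A] {B : Finset (List A)}

theorem mem_Occ_iff {w : List A} {i : ℕ} {b : List A} (hb : b ≠ []) :
    (i, b) ∈ Occ B w ↔ b ∈ B ∧ b <+: w.drop i := by
  have hpos := List.length_pos_iff.mpr hb
  simp only [Occ, Finset.mem_filter, Finset.mem_product, Finset.mem_range]
  constructor
  · rintro ⟨⟨_, h⟩, _, h2⟩
    exact ⟨h, List.prefix_iff_eq_take.mpr h2.symm⟩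
  · rintro ⟨h, h2⟩
    have := h2.length_le
    rw [List.length_drop] at this
    exact ⟨⟨by omega, h⟩, by omega, (List.prefix_iff_eq_take.mp h2).symm⟩

theorem mem_of_mem_Occ {w : List A} {p : ℕ × List A} (h : p ∈ Occ B w) : p.2 ∈ B :=
  (Finset.mem_product.mp (Finset.mem_filter.mp h).1).2

theorem add_length_le_of_mem_Occ {w : List A} {p : ℕ × List A} (h : p ∈ Occ B w) :
    p.1 + p.2.length ≤ w.length :=
  (Finset.mem_filter.mp h).2.1

theorem prefix_drop_of_mem_Occ {w : List A} {p : ℕ × List A} (h : p ∈ Occ B w) :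
    p.2 <+: w.drop p.1 :=
  List.prefix_iff_eq_take.mpr (Finset.mem_filter.mp h).2.2.symm

theorem mem_Occ_append_iff (hB : ∀ b ∈ B, b ≠ []) (s w : List A) (i : ℕ) (b : List A) :
    (i + s.length, b) ∈ Occ B (s ++ w) ↔ (i, b) ∈ Occ B w := by
  by_cases hb : b ∈ B
  · rw [mem_Occ_iff (hB b hb), mem_Occ_iff (hB b hb), add_comm, ← List.drop_drop,
      List.drop_left]
  · exact ⟨fun h => absurd (mem_of_mem_Occ h) hb, fun h => absurd (mem_of_mem_Occ h) hb⟩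

/-- Occurrences starting at later positions end at later positions. -/
theorem end_lt_end_of_start_lt (hfac : ∀ u ∈ B, ∀ v ∈ B, u ≠ v → ¬ u <:+: v) {w : List A}
    {p q : ℕ × List A} (hp : p ∈ Occ B w) (hq : q ∈ Occ B w) (h : p.1 < q.1) :
    p.1 + p.2.length < q.1 + q.2.length := by
  by_contra! hle
  have hne : q.2 ≠ p.2 := by
    intro e
    rw [e] at hle
    omega
  refine hfac _ (mem_of_mem_Occ hq) _ (mem_of_mem_Occ hp) hne ?_
  have h1 : p.2.drop (q.1 - p.1) <+: w.drop q.1 := by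
    have := (prefix_drop_of_mem_Occ hp).drop (q.1 - p.1)
    rwa [List.drop_drop, Nat.add_sub_cancel' h.le] at this
  have h2 : q.2 <+: p.2.drop (q.1 - p.1) :=
    List.prefix_of_prefix_length_le (prefix_drop_of_mem_Occ hq) h1
      (by rw [List.length_drop]; omega)
  exact h2.isInfix.trans (List.drop_suffix _ _).isInfix

theorem eq_of_start_eq (hfac : ∀ u ∈ B, ∀ v ∈ B, u ≠ v → ¬ u <:+: v) {w : List A}
    {p q : ℕ × List A} (hp : p ∈ Occ B w) (hq : q ∈ Occ B w) (h : p.1 = q.1) : p = q := by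
  refine Prod.ext h ?_
  by_contra hne
  have h1 := prefix_drop_of_mem_Occ hp
  have h2 := prefix_drop_of_mem_Occ hq
  rw [h] at h1
  rcases List.prefix_or_prefix_of_prefix h1 h2 with h3 | h3
  · exact hfac _ (mem_of_mem_Occ hp) _ (mem_of_mem_Occ hq) hne h3.isInfix
  · exact hfac _ (mem_of_mem_Occ hq) _ (mem_of_mem_Occ hp) (Ne.symm hne) h3.isInfix

theorem mem_overlapSet {v u r : List A} :
    r ∈ overlapSet v u ↔ r <:+ v ∧ r ≠ [] ∧ r ≠ v ∧ r <+: u ∧ r ≠ u := by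
  simp [overlapSet]

/-- The clusters of length `n` starting with `v`. -/
noncomputable def clustersFrom [Fintype A] (B : Finset (List A)) (v : List A) (n : ℕ) :
    Finset (Σ _ : List A, Finset (ℕ × List A)) :=
  (Finset.univ.image (List.ofFn : (Fin n → A) → List A)).sigma fun w =>
    (Occ B w).powerset.filter fun S => IsCluster B w S ∧ (0, v) ∈ S

theorem mem_clustersFrom [Fintype A] {v : List A} {n : ℕ}
    {x : Σ _ : List A, Finset (ℕ × List A)} :
    x ∈ clustersFrom B v n ↔ x.1.length = n ∧ IsCluster B x.1 x.2 ∧ (0, v) ∈ x.2 := by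
  simp only [clustersFrom, Finset.mem_sigma, Finset.mem_image, Finset.mem_univ, true_and,
    Finset.mem_filter, Finset.mem_powerset]
  constructor
  · rintro ⟨⟨f, hf⟩, _, h⟩
    exact ⟨by rw [← hf, List.length_ofFn], h⟩
  · rintro ⟨rfl, h⟩
    exact ⟨⟨x.1.get, List.ofFn_get _⟩, h.1.1, h⟩

theorem clusterCountFrom_eq_sum [Fintype A] (v : List A) (n : ℕ) :
    clusterCountFrom A B v n = ∑ x ∈ clustersFrom B v n, (-1 : ℤ) ^ x.2.card := by
  rw [clustersFrom, Finset.sum_sigma, Finset.sum_image (fun a _ b _ h => List.ofFn_injective h)]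
  simp only [clusterCountFrom, Finset.sum_filter]

/-- Prepending an overlapping occurrence of `v` to a cluster starting with `u` gives a cluster. -/
theorem IsCluster.cons (hB : ∀ b ∈ B, b ≠ []) {v u s r w : List A}
    {S : Finset (ℕ × List A)} (hv : v ∈ B) (hs : 0 < s.length) (hr : r ≠ [])
    (hvr : s ++ r = v) (hru : r <+: u)
    (hS : IsCluster B w S) (hu : (0, u) ∈ S) :
    IsCluster B (s ++ w) (insert (0, v) (S.map (shiftOcc A s.length))) := by
  obtain ⟨hsub, -, -, hcov, hcon⟩ := hS
  have hlen : s.length < v.length := by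
    have := List.length_pos_iff.mpr hr
    rw [← hvr, List.length_append]
    omega
  refine ⟨?_, Finset.insert_nonempty _ _, ⟨_, Finset.mem_insert_self _ _, rfl⟩, ?_, ?_⟩
  · intro q hq
    rcases Finset.mem_insert.mp hq with rfl | hq
    · rw [mem_Occ_iff (hB v hv)]
      refine ⟨hv, ?_⟩
      rw [← hvr, List.drop_zero, List.prefix_append_right_inj]
      exact hru.trans (by simpa using prefix_drop_of_mem_Occ (hsub hu))
    · obtain ⟨p, hp, rfl⟩ := mem_map_shiftOcc.mp hq
      exact (mem_Occ_append_iff hB s w p.1 p.2).mpr (hsub hp)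
  · intro j hj
    rw [List.length_append] at hj
    by_cases h : j < s.length
    · exact ⟨_, Finset.mem_insert_self _ _, Nat.zero_le _, by dsimp only; omega⟩
    · obtain ⟨p, hp, h1, h2⟩ := hcov (j - s.length) (by omega)
      refine ⟨_, Finset.mem_insert_of_mem (mem_map_shiftOcc.mpr ⟨p, hp, rfl⟩), ?_, ?_⟩ <;>
        dsimp only <;> omega
  · intro p hp q hq hlt hbetween
    rcases Finset.mem_insert.mp hq with rfl | hq
    · simp at hlt
    obtain ⟨q', hq', rfl⟩ := mem_map_shiftOcc.mp hq
    rcases Finset.mem_insert.mp hp with rfl | hp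
    · have hq0 : q'.1 = 0 := by
        by_contra hne
        refine hbetween _ (Finset.mem_insert_of_mem (mem_map_shiftOcc.mpr ⟨_, hu, rfl⟩)) ?_
        constructor <;> dsimp only <;> omega
      have := List.length_pos_iff.mpr (hB _ (mem_of_mem_Occ (hsub hq')))
      refine ⟨s.length, ?_, ?_, ?_, ?_⟩ <;> dsimp only <;> omega
    · obtain ⟨p', hp', rfl⟩ := mem_map_shiftOcc.mp hp
      rw [overlaps_shift_iff]
      refine hcon _ hp' _ hq' (by dsimp only at hlt; omega) fun t ht hbt => ?_
      refine hbetween _ (Finset.mem_insert_of_mem (mem_map_shiftOcc.mpr ⟨t, ht, rfl⟩)) ?_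
      constructor <;> dsimp only <;> omega

/-- Removing the first occurrence from a cluster with several occurrences gives a cluster
starting with a word that overlaps the first one. -/
theorem IsCluster.exists_eq_cons (hB : ∀ b ∈ B, b ≠ [])
    (hfac : ∀ u ∈ B, ∀ v ∈ B, u ≠ v → ¬ u <:+: v) {v w : List A}
    {S : Finset (ℕ × List A)} (hS : IsCluster B w S) (hv : (0, v) ∈ S) (hne : S ≠ {(0, v)}) :
    ∃ u ∈ B, ∃ r ∈ overlapSet v u, ∃ s w' S', s ++ r = v ∧ w = s ++ w' ∧
      S = insert (0, v) (S'.map (shiftOcc A s.length)) ∧ IsCluster B w' S' ∧ (0, u) ∈ S' := by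
  obtain ⟨hsub, -, -, hcov, hcon⟩ := hS
  have herase : (S.erase (0, v)).Nonempty := by
    rw [Finset.nonempty_iff_ne_empty]
    intro h
    rcases (Finset.erase_eq_empty_iff _ _).mp h with h | h
    · simp [h] at hv
    · exact hne h
  obtain ⟨⟨d, u⟩, hdu, hmin⟩ := Finset.exists_min_image _ Prod.fst herase
  obtain ⟨hdu_ne, hdu⟩ := Finset.mem_erase.mp hdu
  have hpos : ∀ p ∈ S, p ≠ (0, v) → 0 < p.1 := fun p hp hpv => by
    by_contra h0
    exact hpv (eq_of_start_eq hfac (hsub hp) (hsub hv) (by dsimp only; omega))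
  have hd : 0 < d := hpos _ hdu hdu_ne
  have hge : ∀ p ∈ S, 0 < p.1 → d ≤ p.1 := fun p hp h0 =>
    hmin p (Finset.mem_erase.mpr ⟨fun h => by simp [h] at h0, hp⟩)
  have hdv : d < v.length := by
    obtain ⟨j, -, h2, h3, -⟩ := hcon _ hv _ hdu hd fun t ht hb => by
      have := hge t ht hb.1
      have := hb.2
      dsimp only at this
      omega
    dsimp only at h2 h3
    omega
  have hend := end_lt_end_of_start_lt hfac (hsub hv) (hsub hdu) hd
  dsimp only at hend
  have hvw : v <+: w := by simpa using prefix_drop_of_mem_Occ (hsub hv)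
  have huw : u <+: w.drop d := prefix_drop_of_mem_Occ (hsub hdu)
  have hds : (v.take d).length = d := by rw [List.length_take]; omega
  have hw : w = v.take d ++ w.drop d := by
    conv_lhs => rw [← List.take_append_drop d w]
    congr 1
    rw [List.prefix_iff_eq_take.mp hvw, List.take_take]
    congr 1
    omega
  set S' : Finset (ℕ × List A) :=
    (S.erase (0, v)).image fun p => (p.1 - d, p.2) with hS'
  have hmem : ∀ p : ℕ × List A, p ∈ S' ↔ (p.1 + d, p.2) ∈ S := by
    intro p
    rw [hS', Finset.mem_image]
    constructor
    · rintro ⟨q, hq, rfl⟩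
      obtain ⟨hqv, hq⟩ := Finset.mem_erase.mp hq
      have := hge q hq (hpos q hq hqv)
      dsimp only
      rwa [Nat.sub_add_cancel this]
    · intro h
      refine ⟨_, Finset.mem_erase.mpr ⟨fun e => ?_, h⟩, by simp⟩
      have := congrArg Prod.fst e
      dsimp only at this
      omega
  have hback : ∀ p ∈ S, 0 < p.1 → (p.1 - d, p.2) ∈ S' := fun p hp h0 => by
    rw [hmem]
    dsimp only
    rwa [Nat.sub_add_cancel (hge p hp h0)]
  refine ⟨u, mem_of_mem_Occ (hsub hdu), v.drop d, ?_, v.take d, w.drop d, S',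
    List.take_append_drop d v, hw, ?_, ?_, ?_⟩
  · have hlen : (v.drop d).length = v.length - d := List.length_drop
    refine mem_overlapSet.mpr ⟨List.drop_suffix _ _, ?_, ?_, ?_, ?_⟩
    · rw [← List.length_pos_iff]
      omega
    · intro h
      rw [h] at hlen
      omega
    · exact List.prefix_of_prefix_length_le (hvw.drop d) huw (by omega)
    · intro h
      rw [h] at hlen
      omega
  · ext q
    rw [Finset.mem_insert, mem_map_shiftOcc, hds]
    constructor
    · intro hq
      by_cases hqv : q = (0, v)
      · exact Or.inl hqv
      · have h0 := hpos q hq hqv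
        exact Or.inr ⟨_, hback q hq h0, by simp [Nat.sub_add_cancel (hge q hq h0)]⟩
    · rintro (rfl | ⟨p, hp, rfl⟩)
      · exact hv
      · exact (hmem p).mp hp
  · have h0u : (0, u) ∈ S' := (hmem _).mpr (by simpa using hdu)
    refine ⟨fun p hp => ?_, ⟨_, h0u⟩, ⟨_, h0u, rfl⟩, fun j hj => ?_, fun p hp q hq hlt hbt => ?_⟩
    · have := hsub ((hmem p).mp hp)
      rw [hw] at this
      exact (mem_Occ_append_iff hB (v.take d) (w.drop d) p.1 p.2).mp (by rwa [hds])
    · rw [List.length_drop] at hj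
      obtain ⟨p, hp, h1, h2⟩ := hcov (j + d) (by omega)
      by_cases hpv : p = (0, v)
      · subst hpv
        dsimp only at h1 h2
        exact ⟨_, h0u, Nat.zero_le _, by dsimp only; omega⟩
      · have h0 := hpos p hp hpv
        have := hge p hp h0
        exact ⟨_, hback p hp h0, by dsimp only; omega, by dsimp only; omega⟩
    · rw [← overlaps_shift_iff d]
      refine hcon _ ((hmem p).mp hp) _ ((hmem q).mp hq) (by dsimp only; omega)
        fun t ht hb => ?_
      dsimp only at hb
      have h0 : 0 < t.1 := by omega
      have := hge t ht h0
      refine hbt _ (hback t ht h0) ?_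
      dsimp only
      omega
  · exact (hmem _).mpr (by simpa using hdu)

theorem isCluster_singleton_iff (hB : ∀ b ∈ B, b ≠ []) {v : List A} (hv : v ∈ B) {w : List A} :
    IsCluster B w {(0, v)} ↔ w = v := by
  constructor
  · rintro ⟨hsub, -, -, hcov, -⟩
    have hmem := hsub (Finset.mem_singleton_self _)
    have hvw : v <+: w := by simpa using prefix_drop_of_mem_Occ hmem
    refine (hvw.eq_of_length_le ?_).symm
    by_contra! hlt
    obtain ⟨p, hp, -, h⟩ := hcov _ hlt
    rw [Finset.mem_singleton.mp hp] at h
    simp at h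
  · rintro rfl
    refine ⟨?_, Finset.singleton_nonempty _, ⟨_, Finset.mem_singleton_self _, rfl⟩, ?_, ?_⟩
    · rw [Finset.singleton_subset_iff, mem_Occ_iff (hB _ hv)]
      exact ⟨hv, by simp⟩
    · intro j hj
      exact ⟨_, Finset.mem_singleton_self _, Nat.zero_le _, by simpa using hj⟩
    · intro p hp q hq hlt
      rw [Finset.mem_singleton.mp hp, Finset.mem_singleton.mp hq] at hlt
      exact absurd hlt (lt_irrefl _)

theorem sum_singleton_clustersFrom [Fintype A] (hB : ∀ b ∈ B, b ≠ []) {v : List A} (hv : v ∈ B)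
    (n : ℕ) :
    ∑ x ∈ (clustersFrom B v n).filter (fun x => x.2 = {(0, v)}), (-1 : ℤ) ^ x.2.card =
      -(if n = v.length then 1 else 0) := by
  have hmem : ∀ x, x ∈ (clustersFrom B v n).filter (fun x => x.2 = {(0, v)}) ↔
      n = v.length ∧ x = ⟨v, {(0, v)}⟩ := by
    rintro ⟨w, S⟩
    rw [Finset.mem_filter, mem_clustersFrom]
    dsimp only
    constructor
    · rintro ⟨⟨hn, hS, -⟩, rfl⟩
      obtain rfl := (isCluster_singleton_iff hB hv).mp hS
      exact ⟨hn.symm, rfl⟩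
    · rintro ⟨hn, h⟩
      cases h
      exact ⟨⟨hn.symm, (isCluster_singleton_iff hB hv).mpr rfl, Finset.mem_singleton_self _⟩, rfl⟩
  split_ifs with hn
  · have : (clustersFrom B v n).filter (fun x => x.2 = {(0, v)}) = {⟨v, {(0, v)}⟩} := by
      ext x
      rw [hmem, Finset.mem_singleton]
      exact and_iff_right hn
    rw [this, Finset.sum_singleton]
    simp
  · rw [Finset.sum_eq_zero fun x hx => absurd ((hmem x).mp hx).1 hn]
    simp

theorem sum_nonsingleton_clustersFrom [Fintype A] (hB : ∀ b ∈ B, b ≠ [])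
    (hfac : ∀ u ∈ B, ∀ v ∈ B, u ≠ v → ¬ u <:+: v) {v : List A} (hv : v ∈ B) {n : ℕ}
    (hn : v.length ≤ n) :
    ∑ x ∈ (clustersFrom B v n).filter (fun x => ¬ x.2 = {(0, v)}), (-1 : ℤ) ^ x.2.card =
      -∑ u ∈ B, ∑ r ∈ overlapSet v u, clusterCountFrom A B u (n - v.length + r.length) := by
  simp only [clusterCountFrom_eq_sum]
  rw [← Finset.sum_neg_distrib]
  simp only [← Finset.sum_neg_distrib]
  simp only [Finset.sum_sigma']
  have key : ∀ u r : List A, r ∈ overlapSet v u →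
      v.take (v.length - r.length) ++ r = v ∧ 0 < (v.take (v.length - r.length)).length ∧
      (v.take (v.length - r.length)).length + r.length = v.length := by
    intro u r hr
    obtain ⟨⟨s, rfl⟩, -, hne, -⟩ := mem_overlapSet.mp hr
    have hs : s ≠ [] := by
      rintro rfl
      exact hne rfl
    have := List.length_pos_iff.mpr hs
    simpa using this
  symm
  refine Finset.sum_bij
    (fun x _ => ⟨v.take (v.length - x.2.1.length) ++ x.2.2.1,
      insert (0, v) (x.2.2.2.map (shiftOcc A (v.take (v.length - x.2.1.length)).length))⟩)
    ?_ ?_ ?_ ?_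
  · rintro ⟨u, r, w, S⟩ hx
    simp only [Finset.mem_sigma, mem_clustersFrom] at hx
    obtain ⟨hu, hr, hw, hS, huS⟩ := hx
    obtain ⟨k1, k2, k3⟩ := key u r hr
    obtain ⟨-, hr0, -, hru, -⟩ := mem_overlapSet.mp hr
    rw [Finset.mem_filter, mem_clustersFrom]
    refine ⟨⟨?_, hS.cons hB hv k2 hr0 k1 hru huS, Finset.mem_insert_self _ _⟩, fun h => ?_⟩
    · rw [List.length_append]
      dsimp only
      omega
    · have h1 := Finset.mem_insert_of_mem (b := (0, v))
        (mem_map_shiftOcc.mpr ⟨_, huS, rfl⟩ :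
          _ ∈ S.map (shiftOcc A (v.take (v.length - r.length)).length))
      dsimp only at h
      rw [h, Finset.mem_singleton] at h1
      have := congrArg Prod.fst h1
      dsimp only at this
      omega
  · rintro ⟨u₁, r₁, w₁, S₁⟩ hx₁ ⟨u₂, r₂, w₂, S₂⟩ hx₂ heq
    simp only [Finset.mem_sigma, mem_clustersFrom] at hx₁ hx₂
    obtain ⟨hu₁, hr₁, hw₁, hS₁, huS₁⟩ := hx₁
    obtain ⟨hu₂, hr₂, hw₂, hS₂, huS₂⟩ := hx₂
    obtain ⟨k1, k2, k3⟩ := key _ _ hr₁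
    obtain ⟨l1, l2, l3⟩ := key _ _ hr₂
    simp only [Sigma.mk.injEq, heq_eq_eq] at heq
    obtain ⟨hw, hS⟩ := heq
    have hmap : S₁.map (shiftOcc A (v.take (v.length - r₁.length)).length) =
        S₂.map (shiftOcc A (v.take (v.length - r₂.length)).length) := by
      rw [← Finset.erase_insert (zero_notMem_map_shiftOcc (S := S₁) k2 v), hS,
        Finset.erase_insert (zero_notMem_map_shiftOcc l2 v)]
    have hle₁ : (v.take (v.length - r₁.length)).length ≤
        (v.take (v.length - r₂.length)).length := by
      have h := mem_map_shiftOcc (d := (v.take (v.length - r₂.length)).length).mpr ⟨_, huS₂, rfl⟩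
      rw [← hmap] at h
      obtain ⟨p, -, hp⟩ := mem_map_shiftOcc.mp h
      have := congrArg Prod.fst hp
      dsimp only at this
      omega
    have hle₂ : (v.take (v.length - r₂.length)).length ≤
        (v.take (v.length - r₁.length)).length := by
      have h := mem_map_shiftOcc (d := (v.take (v.length - r₁.length)).length).mpr ⟨_, huS₁, rfl⟩
      rw [hmap] at h
      obtain ⟨p, -, hp⟩ := mem_map_shiftOcc.mp h
      have := congrArg Prod.fst hp
      dsimp only at this
      omega
    have hr : r₁ = r₂ := (List.append_inj (k1.trans l1.symm) (le_antisymm hle₁ hle₂)).2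
    subst hr
    obtain rfl := Finset.map_injective _ hmap
    obtain rfl := List.append_cancel_left hw
    obtain rfl : u₁ = u₂ :=
      congrArg Prod.snd (eq_of_start_eq hfac (hS₁.1 huS₁) (hS₁.1 huS₂) rfl)
    rfl
  · rintro ⟨w, S⟩ hx
    rw [Finset.mem_filter, mem_clustersFrom] at hx
    obtain ⟨⟨hw, hS, hvS⟩, hne⟩ := hx
    obtain ⟨u, hu, r, hr, s, w', S', hs, rfl, rfl, hS', huS'⟩ :=
      hS.exists_eq_cons hB hfac hvS hne
    have hlen := congrArg List.length hs
    rw [List.length_append] at hlen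
    have htake : v.take (v.length - r.length) = s := by
      rw [← hs]
      simp
    refine ⟨⟨u, r, w', S'⟩, ?_, ?_⟩
    · simp only [Finset.mem_sigma, mem_clustersFrom]
      dsimp only at hw
      rw [List.length_append] at hw
      exact ⟨hu, hr, by omega, hS', huS'⟩
    · dsimp only
      rw [htake]
  · rintro ⟨u, r, w, S⟩ hx
    obtain ⟨-, k2, -⟩ := key u r (Finset.mem_sigma.mp (Finset.mem_sigma.mp hx).2).1
    dsimp only
    rw [Finset.card_insert_of_notMem (zero_notMem_map_shiftOcc k2 v), Finset.card_map, pow_succ]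
    ring

end ClusterRecursion

/-- The recursion for the cluster numbers `c_v(n)`: they vanish for `n < |v|`, and for
`n ≥ |v|`, `c_v(n) = -[n = |v|] - Σ_{u ∈ B} Σ_{r ∈ O(v,u)} c_u(n - |v| + |r|)`. -/
theorem cluster_count_recursion (A : Type) [Fintype A] [DecidableEq A]
    (B : Finset (List A)) (hB : ∀ b ∈ B, b ≠ [])
    (hfac : ∀ u ∈ B, ∀ v ∈ B, u ≠ v → ¬ u <:+: v)
    (v : List A) (hv : v ∈ B) :
    (∀ n, n < v.length → clusterCountFrom A B v n = 0) ∧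
      (∀ n, v.length ≤ n →
        clusterCountFrom A B v n =
          -(if n = v.length then 1 else 0) -
            ∑ u ∈ B, ∑ r ∈ overlapSet v u,
              clusterCountFrom A B u (n - v.length + r.length)) := by
  constructor
  · intro n hn
    rw [clusterCountFrom_eq_sum]
    refine Finset.sum_eq_zero fun x hx => ?_
    obtain ⟨hlen, hS, hvS⟩ := mem_clustersFrom.mp hx
    have := add_length_le_of_mem_Occ (hS.1 hvS)
    dsimp only at this
    omega
  · intro n hn
    rw [clusterCountFrom_eq_sum, ← Finset.sum_filter_add_sum_filter_not _ (fun x => x.2 = {(0, v)}),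
      sum_singleton_clustersFrom hB hv, sum_nonsingleton_clustersFrom hB hfac hv hn, sub_eq_add_neg]
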